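/- Let μ be a box-like self-affine measure. For every q ≥ 1, the lower L^q-spectrum of μ satisfies γ(q) ≤ τ̲_μ(q). -/

import Mathlib

open MeasureTheory Filter Set

attribute [local instance] Classical.propDecidable

noncomputable section

/-- Data of a box-like planar self-affine IFS: each map is `S i = T i ∘ L i + t i`, where
`T i` is the diagonal contraction `diag (c i, d i)` with `c i, d i ∈ (0,1)` and `L i` is a
linear isometry of the plane preserving `[-1,1]²`, i.e. one of the eight symmetries of the
square, encoded by whether it swaps the two axes (`swap`) and by a sign on each coordinate. -/
structure IFSData (ι : Type) where
  c : ι → ℝ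
  d : ι → ℝ
  swap : ι → Bool
  sgn1 : ι → Bool
  sgn2 : ι → Bool
  t : ι → ℝ × ℝ

namespace IFSData

variable {ι : Type}

/-- The affine contraction `S i = T i ∘ L i + t i`. -/
def S (B : IFSData ι) (i : ι) (x : ℝ × ℝ) : ℝ × ℝ :=
  ((if B.sgn1 i then 1 else -1) * (B.c i * (if B.swap i then x.2 else x.1)) + (B.t i).1,
   (if B.sgn2 i then 1 else -1) * (B.d i * (if B.swap i then x.1 else x.2)) + (B.t i).2)

/-- `(b(i), h(i))`: base and height of the rectangle `S_i([0,1]²)` for a finite word `i`. -/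
def dims (B : IFSData ι) (l : List ι) : ℝ × ℝ :=
  l.foldr (fun i w =>
    (B.c i * (if B.swap i then w.2 else w.1), B.d i * (if B.swap i then w.1 else w.2))) (1, 1)

/-- `α₁(i)`: the larger singular value of the linear part of `S_i`. -/
def alpha1 (B : IFSData ι) (l : List ι) : ℝ := max (B.dims l).1 (B.dims l).2

/-- `α₂(i)`: the smaller singular value of the linear part of `S_i`. -/
def alpha2 (B : IFSData ι) (l : List ι) : ℝ := min (B.dims l).1 (B.dims l).2

/-- Whether the composite map of the word maps horizontal lines to vertical lines. -/
def swapW (B : IFSData ι) (l : List ι) : Bool := l.foldr (fun i b => xor (B.swap i) b) false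

/-- The composite map `S_{i₁} ∘ ⋯ ∘ S_{i_k}` of a word. -/
def Sw (B : IFSData ι) (l : List ι) : ℝ × ℝ → ℝ × ℝ := l.foldr (fun i f => B.S i ∘ f) id

/-- The word `i` projects onto the first coordinate, i.e. `π_i = π₁`. -/
def usesPi1 (B : IFSData ι) (l : List ι) : Prop :=
  (B.swapW l = false ∧ (B.dims l).2 ≤ (B.dims l).1) ∨
    (B.swapW l = true ∧ (B.dims l).1 < (B.dims l).2)

/-- The projection `π_i` onto the direction of the longest side of `S_i([0,1]²)`. -/
def projW (B : IFSData ι) (l : List ι) : ℝ × ℝ → ℝ :=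
  if B.usesPi1 l then Prod.fst else Prod.snd

/-- The rectangular open set condition. -/
def ROSC (B : IFSData ι) : Prop :=
  ∃ x₁ x₂ y₁ y₂ : ℝ, x₁ < x₂ ∧ y₁ < y₂ ∧
    (∀ i, B.S i '' (Set.Ioo x₁ x₂ ×ˢ Set.Ioo y₁ y₂) ⊆ Set.Ioo x₁ x₂ ×ˢ Set.Ioo y₁ y₂) ∧
    Pairwise fun i j =>
      Disjoint (B.S i '' (Set.Ioo x₁ x₂ ×ˢ Set.Ioo y₁ y₂))
        (B.S j '' (Set.Ioo x₁ x₂ ×ˢ Set.Ioo y₁ y₂))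

end IFSData

/-- `p(i)`: the probability of a finite word. -/
def wordProb {ι : Type} (p : ι → ℝ) (l : List ι) : ℝ := (l.map p).prod

/-- `τ_i(q)`: the value of the `L^q`-spectrum of the projection `π_i μ`. -/
def tauW {ι : Type} (B : IFSData ι) (τ1 τ2 : ℝ → ℝ) (l : List ι) (q : ℝ) : ℝ :=
  if B.usesPi1 l then τ1 q else τ2 q

/-- The `q`-modified singular value function `ψ^{s,q}`. -/
def psiSV {ι : Type} (B : IFSData ι) (p : ι → ℝ) (τ1 τ2 : ℝ → ℝ) (s q : ℝ) (l : List ι) : ℝ :=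
  wordProb p l ^ q * B.alpha1 l ^ tauW B τ1 τ2 l q * B.alpha2 l ^ (s - tauW B τ1 τ2 l q)

/-- `Ψ_k^{s,q} = ∑_{i ∈ I^k} ψ^{s,q}(i)`. -/
def PsiSV {ι : Type} [Fintype ι] (B : IFSData ι) (p : ι → ℝ) (τ1 τ2 : ℝ → ℝ)
    (k : ℕ) (s q : ℝ) : ℝ :=
  ∑ f : Fin k → ι, psiSV B p τ1 τ2 s q (List.ofFn f)

/-- The lower `L^q`-spectrum of a measure. -/
def lowerLq {X : Type*} [MeasurableSpace X] [PseudoMetricSpace X] (ν : Measure X) (q : ℝ) : ℝ :=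
  liminf (fun δ : ℝ =>
      Real.log (∫ x, (ν (Metric.ball x δ)).toReal ^ (q - 1) ∂ν) / (-Real.log δ))
    (nhdsWithin 0 (Set.Ioi 0))

/-- The upper `L^q`-spectrum of a measure. -/
def upperLq {X : Type*} [MeasurableSpace X] [PseudoMetricSpace X] (ν : Measure X) (q : ℝ) : ℝ :=
  limsup (fun δ : ℝ =>
      Real.log (∫ x, (ν (Metric.ball x δ)).toReal ^ (q - 1) ∂ν) / (-Real.log δ))
    (nhdsWithin 0 (Set.Ioi 0))

/-- The `L^q`-spectrum of `ν` exists and equals `t`. -/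
def IsLqSpec {X : Type*} [MeasurableSpace X] [PseudoMetricSpace X]
    (ν : Measure X) (q t : ℝ) : Prop :=
  lowerLq ν q = t ∧ upperLq ν q = t

/-- `α_min = min_{i ∈ I} α₂(i)`. -/
def alphaMin {ι : Type} [Fintype ι] [Nonempty ι] (B : IFSData ι) : ℝ :=
  Finset.univ.inf' Finset.univ_nonempty fun i => min (B.c i) (B.d i)

/-- `α_max = max_{i ∈ I} α₁(i)`. -/
def alphaMax {ι : Type} [Fintype ι] [Nonempty ι] (B : IFSData ι) : ℝ :=
  Finset.univ.sup' Finset.univ_nonempty fun i => max (B.c i) (B.d i)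

/-- `p_max = max_{i ∈ I} p_i`. -/
def pMax {ι : Type} [Fintype ι] [Nonempty ι] (p : ι → ℝ) : ℝ :=
  Finset.univ.sup' Finset.univ_nonempty p

/-- The `δ`-stopping `I_δ`. -/
def stopping {ι : Type} (B : IFSData ι) (δ : ℝ) : Set (List ι) :=
  {l | l ≠ [] ∧ B.alpha2 l < δ ∧ δ ≤ B.alpha2 l.dropLast}

/-- Rectangle integral. -/
def GG {X : Type*} [MeasurableSpace X] (μ : Measure X) (π π' : X → ℝ) (q r₁ r₂ : ℝ) : ENNReal :=
  ∫⁻ x, (μ {y | |π y - π x| < r₁ ∧ |π' y - π' x| < r₂}) ^ (q - 1) ∂μ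

/-- Strip integral. -/
def DD {X : Type*} [MeasurableSpace X] (μ : Measure X) (π : X → ℝ) (q r : ℝ) : ENNReal :=
  ∫⁻ x, (μ {y | |π y - π x| < r}) ^ (q - 1) ∂μ

theorem meas_rect {X : Type*} [MeasurableSpace X] (μ : Measure X) [IsProbabilityMeasure μ]
    {π π' : X → ℝ} (hπ : Measurable π) (hπ' : Measurable π') (r₁ r₂ : ℝ) :
    Measurable fun x => μ {y | |π y - π x| < r₁ ∧ |π' y - π' x| < r₂} := by
  have h : MeasurableSet {z : X × X | |π z.2 - π z.1| < r₁ ∧ |π' z.2 - π' z.1| < r₂} := by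
    have m1 : MeasurableSet {z : X × X | |π z.2 - π z.1| < r₁} :=
      measurableSet_lt (by fun_prop) measurable_const
    have m2 : MeasurableSet {z : X × X | |π' z.2 - π' z.1| < r₂} :=
      measurableSet_lt (by fun_prop) measurable_const
    exact m1.inter m2
  exact measurable_measure_prodMk_left h

theorem meas_strip {X : Type*} [MeasurableSpace X] (μ : Measure X) [IsProbabilityMeasure μ]
    {π : X → ℝ} (hπ : Measurable π) (r₁ : ℝ) :
    Measurable fun x => μ {y | |π y - π x| < r₁} := by
  have h : MeasurableSet {z : X × X | |π z.2 - π z.1| < r₁} := by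
    exact measurableSet_lt (by fun_prop) measurable_const
  exact measurable_measure_prodMk_left h

theorem DD_mono {X : Type*} [MeasurableSpace X] (μ : Measure X) (π : X → ℝ) {q r r' : ℝ}
    (hq : 1 ≤ q) (h : r ≤ r') : DD μ π q r ≤ DD μ π q r' := by
  unfold DD
  apply lintegral_mono
  intro x
  apply ENNReal.rpow_le_rpow _ (by linarith)
  apply measure_mono
  intro y hy
  exact lt_of_lt_of_le hy h

theorem GG_ge_DD {X : Type*} [MeasurableSpace X] (μ : Measure X) (π π' : X → ℝ) {q r₁ r₂ M : ℝ}
    (hq : 1 ≤ q) {K : Set X} (hK : μ Kᶜ = 0) (hKM : ∀ x ∈ K, ∀ y ∈ K, |π' y - π' x| < M)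
    (h : M ≤ r₂) : DD μ π q r₁ ≤ GG μ π π' q r₁ r₂ := by
  unfold DD GG
  apply lintegral_mono_ae
  have hKae : ∀ᵐ x ∂μ, x ∈ K := hK
  filter_upwards [hKae] with x hx
  apply ENNReal.rpow_le_rpow _ (by linarith)
  apply measure_mono_ae
  filter_upwards [hKae] with y hy h1
  exact ⟨h1, (hKM x hx y hy).trans_le h⟩

theorem GG_step {X κ : Type*} [MeasurableSpace X] (μ : Measure X) [IsProbabilityMeasure μ]
    {π π' : X → ℝ} (hπ : Measurable π) (hπ' : Measurable π') {q : ℝ} (hq : 1 ≤ q)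
    (A : Finset κ) (T : κ → X → X) (P a b : κ → ℝ)
    (hP : ∀ w ∈ A, 0 < P w) (ha : ∀ w ∈ A, 0 < a w) (hb : ∀ w ∈ A, 0 < b w)
    (hTa : ∀ w ∈ A, ∀ x y, |π (T w y) - π (T w x)| = a w * |π y - π x|)
    (hTb : ∀ w ∈ A, ∀ x y, |π' (T w y) - π' (T w x)| = b w * |π' y - π' x|)
    (hT : ∀ w, Measurable (T w))
    (hAint : ∀ g : X → ENNReal, Measurable g →
      ∑ w ∈ A, ENNReal.ofReal (P w) * ∫⁻ x, g (T w x) ∂μ ≤ ∫⁻ x, g x ∂μ) (r₁ r₂ : ℝ) :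
    ∑ w ∈ A, ENNReal.ofReal (P w ^ q) * GG μ π π' q (r₁ / a w) (r₂ / b w) ≤ GG μ π π' q r₁ r₂ := by
  have hq' : 0 ≤ q - 1 := by linarith
  have hset : ∀ w ∈ A, ∀ s : Set X, MeasurableSet s →
      ENNReal.ofReal (P w) * μ (T w ⁻¹' s) ≤ μ s := by
    intro w hw s hs
    have := hAint (s.indicator 1) (measurable_one.indicator hs)
    rw [lintegral_indicator_one hs] at this
    refine le_trans ?_ this
    refine le_trans (le_of_eq ?_) (Finset.single_le_sum (fun _ _ => zero_le) hw)
    congr 1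
    have h2 : (fun x => s.indicator (1 : X → ENNReal) (T w x)) = (T w ⁻¹' s).indicator 1 := by
      ext x; simp [Set.indicator]
    rw [h2, lintegral_indicator_one (hT w hs)]
  have h1 := hAint (fun x => (μ {y | |π y - π x| < r₁ ∧ |π' y - π' x| < r₂}) ^ (q - 1))
    ((meas_rect μ hπ hπ' r₁ r₂).pow_const _)
  refine le_trans (Finset.sum_le_sum ?_) h1
  intro w hw
  have hPq : ENNReal.ofReal (P w ^ q) = ENNReal.ofReal (P w) * ENNReal.ofReal (P w) ^ (q - 1) := by
    rw [ENNReal.ofReal_rpow_of_pos (hP w hw), ← ENNReal.ofReal_mul (hP w hw).le]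
    congr 1
    rw [Real.rpow_sub_one (hP w hw).ne']
    field_simp [(hP w hw).ne']
  rw [hPq, mul_assoc]
  gcongr
  unfold GG
  rw [← lintegral_const_mul _ ((meas_rect μ hπ hπ' _ _).pow_const _)]
  apply lintegral_mono
  intro x
  dsimp only
  rw [← ENNReal.mul_rpow_of_nonneg _ _ hq']
  apply ENNReal.rpow_le_rpow _ hq'
  have hm : MeasurableSet {y | |π y - π (T w x)| < r₁ ∧ |π' y - π' (T w x)| < r₂} := by
    have m1 : MeasurableSet {y | |π y - π (T w x)| < r₁} :=
      measurableSet_lt (by fun_prop) measurable_const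
    have m2 : MeasurableSet {y | |π' y - π' (T w x)| < r₂} :=
      measurableSet_lt (by fun_prop) measurable_const
    exact m1.inter m2
  refine le_trans (le_of_eq ?_) (hset w hw _ hm)
  congr 2
  ext y
  simp only [mem_ofPred_eq, mem_preimage]
  rw [hTa w hw, hTb w hw, lt_div_iff₀ (ha w hw), lt_div_iff₀ (hb w hw), mul_comm (a w), mul_comm (b w)]

theorem rpow_bdd (e l u : ℝ) (hl : 0 < l) : ∃ C > 0, ∀ r, l ≤ r → r ≤ u → r ^ e ≤ C := by
  have hc : ContinuousOn (fun r : ℝ => r ^ e) (Icc l u) := by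
    intro r hr
    exact (Real.continuousAt_rpow_const r e (Or.inl (by linarith [hr.1]))).continuousWithinAt
  obtain ⟨C, hC⟩ := isCompact_Icc.exists_bound_of_continuousOn hc
  refine ⟨|C| + 1, by positivity, fun r h1 h2 => ?_⟩
  have := hC r ⟨h1, h2⟩
  have h3 := le_abs_self (r ^ e)
  have h4 := le_abs_self C
  rw [Real.norm_eq_abs] at this
  linarith

theorem core_bound {X κ : Type*} [MeasurableSpace X] (μ : Measure X) [IsProbabilityMeasure μ]
    {π π' : X → ℝ} (hπ : Measurable π) (hπ' : Measurable π') {q : ℝ} (hq : 1 ≤ q)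
    (A : Finset κ) (T : κ → X → X) (P a b : κ → ℝ)
    (hP : ∀ w ∈ A, 0 < P w) (hb : ∀ w ∈ A, 0 < b w) (hba : ∀ w ∈ A, b w ≤ a w)
    (hTa : ∀ w ∈ A, ∀ x y, |π (T w y) - π (T w x)| = a w * |π y - π x|)
    (hTb : ∀ w ∈ A, ∀ x y, |π' (T w y) - π' (T w x)| = b w * |π' y - π' x|)
    (hT : ∀ w, Measurable (T w))
    (hAint : ∀ g : X → ENNReal, Measurable g →
      ∑ w ∈ A, ENNReal.ofReal (P w) * ∫⁻ x, g (T w x) ∂μ ≤ ∫⁻ x, g x ∂μ)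
    {M : ℝ} (hM : 0 < M)
    {K : Set X} (hK : μ Kᶜ = 0) (hKM : ∀ x ∈ K, ∀ y ∈ K, |π' y - π' x| < M)
    {bmin β : ℝ} (hbmin : 0 < bmin) (hbm : ∀ w ∈ A, bmin ≤ b w)
    (hβ0 : 0 < β) (hβ : β < 1) (hbβ : ∀ w ∈ A, b w ≤ β)
    (s τ : ℝ) (hsum : 1 ≤ ∑ w ∈ A, P w ^ q * a w ^ τ * b w ^ (s - τ))
    (hD : ∀ᶠ r in nhdsWithin (0:ℝ) (Ioi 0), ENNReal.ofReal (r ^ (-τ)) ≤ DD μ π q r) :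
    ∃ c > 0, ∀ r, 0 < r → r ≤ M → ENNReal.ofReal (c * r ^ (-s)) ≤ GG μ π π' q r r := by
  have ha : ∀ w ∈ A, 0 < a w := fun w hw => (hb w hw).trans_le (hba w hw)
  have hbase : ∃ c > 0, ∀ r₁ r₂, 0 < r₁ → r₁ ≤ r₂ → M ≤ r₂ → r₂ ≤ M / bmin →
      ENNReal.ofReal (c * (r₁ ^ (-τ) * r₂ ^ (-(s - τ)))) ≤ GG μ π π' q r₁ r₂ := by
    obtain ⟨δ, hδ, hDδ⟩ := mem_nhdsGT_iff_exists_Ioo_subset.mp hD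
    have hδ : 0 < δ := hδ
    have hδ2 : 0 < δ / 2 := by linarith
    obtain ⟨C1, hC1, hC1'⟩ := rpow_bdd (-τ) (δ / 2) (M / bmin) hδ2
    obtain ⟨C2, hC2, hC2'⟩ := rpow_bdd (-(s - τ)) M (M / bmin) hM
    have hd2 : 0 < (δ / 2) ^ (-τ) := Real.rpow_pos_of_pos hδ2 _
    refine ⟨min 1 ((δ / 2) ^ (-τ) / C1) / C2, by positivity, fun r₁ r₂ h1 h12 hM2 hM2' => ?_⟩
    refine le_trans ?_ (GG_ge_DD μ π π' hq hK hKM hM2)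
    have hr1 : 0 < r₁ ^ (-τ) := Real.rpow_pos_of_pos h1 _
    have hr2 : 0 < r₂ ^ (-(s - τ)) := Real.rpow_pos_of_pos (by linarith) _
    have hle : min 1 ((δ / 2) ^ (-τ) / C1) / C2 * (r₁ ^ (-τ) * r₂ ^ (-(s - τ))) ≤
        min 1 ((δ / 2) ^ (-τ) / C1) * r₁ ^ (-τ) := by
      have h3 : r₂ ^ (-(s - τ)) / C2 ≤ 1 := (div_le_one hC2).2 (hC2' r₂ hM2 hM2')
      have h4 : 0 ≤ min 1 ((δ / 2) ^ (-τ) / C1) * r₁ ^ (-τ) := by positivity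
      calc _ = (min 1 ((δ / 2) ^ (-τ) / C1) * r₁ ^ (-τ)) * (r₂ ^ (-(s - τ)) / C2) := by ring
        _ ≤ _ := mul_le_of_le_one_right h4 h3
    refine le_trans (ENNReal.ofReal_le_ofReal hle) ?_
    by_cases hr : r₁ < δ
    · refine le_trans (ENNReal.ofReal_le_ofReal ?_) (hDδ ⟨h1, hr⟩)
      exact mul_le_of_le_one_left hr1.le (min_le_left _ _)
    · push Not at hr
      have h5 := hDδ (show δ / 2 ∈ Ioo 0 δ from ⟨hδ2, by linarith⟩)
      refine le_trans (le_trans (ENNReal.ofReal_le_ofReal ?_) h5)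
        (DD_mono μ π hq (show δ / 2 ≤ r₁ by linarith))
      have h6 := hC1' r₁ (by linarith) (by linarith)
      calc _ ≤ ((δ / 2) ^ (-τ) / C1) * C1 := by
            apply mul_le_mul (min_le_right _ _) h6 hr1.le (by positivity)
        _ = _ := by field_simp
  obtain ⟨c, hc, hbase⟩ := hbase
  have key : ∀ n : ℕ, ∀ r₁ r₂, 0 < r₁ → r₁ ≤ r₂ → M * β ^ n ≤ r₂ → r₂ ≤ M / bmin →
      ENNReal.ofReal (c * (r₁ ^ (-τ) * r₂ ^ (-(s - τ)))) ≤ GG μ π π' q r₁ r₂ := by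
    intro n
    induction n with
    | zero =>
      intro r₁ r₂ h1 h2 h3 h4
      exact hbase r₁ r₂ h1 h2 (by simpa using h3) h4
    | succ n ih =>
      intro r₁ r₂ h1 h2 h3 h4
      by_cases hM2 : M ≤ r₂
      · exact hbase r₁ r₂ h1 h2 hM2 h4
      push Not at hM2
      have h20 : 0 < r₂ := by linarith
      refine le_trans ?_ (GG_step μ hπ hπ' hq A T P a b hP ha hb hTa hTb hT hAint r₁ r₂)
      have hr1 : 0 < r₁ ^ (-τ) := Real.rpow_pos_of_pos h1 _
      have hr2 : 0 < r₂ ^ (-(s - τ)) := Real.rpow_pos_of_pos h20 _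
      have hterm : ∀ w ∈ A, ENNReal.ofReal (P w ^ q *
          (c * ((r₁ / a w) ^ (-τ) * (r₂ / b w) ^ (-(s - τ))))) ≤
          ENNReal.ofReal (P w ^ q) * GG μ π π' q (r₁ / a w) (r₂ / b w) := by
        intro w hw
        rw [ENNReal.ofReal_mul (Real.rpow_nonneg (hP w hw).le _)]
        gcongr
        have hbw := hb w hw
        apply ih
        · exact div_pos h1 (ha w hw)
        · exact div_le_div₀ h20.le h2 hbw (hba w hw)
        · rw [le_div_iff₀ hbw]
          calc M * β ^ n * b w ≤ M * β ^ n * β := by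
                apply mul_le_mul_of_nonneg_left (hbβ w hw); positivity
            _ = M * β ^ (n + 1) := by ring
            _ ≤ r₂ := h3
        · exact div_le_div₀ hM.le hM2.le hbmin (hbm w hw)
      refine le_trans ?_ (Finset.sum_le_sum hterm)
      rw [← ENNReal.ofReal_sum_of_nonneg]
      · apply ENNReal.ofReal_le_ofReal
        have heq : ∑ w ∈ A, P w ^ q * (c * ((r₁ / a w) ^ (-τ) * (r₂ / b w) ^ (-(s - τ)))) =
            (c * (r₁ ^ (-τ) * r₂ ^ (-(s - τ)))) * ∑ w ∈ A, P w ^ q * a w ^ τ * b w ^ (s - τ) := by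
          rw [Finset.mul_sum]
          apply Finset.sum_congr rfl
          intro w hw
          rw [Real.div_rpow h1.le (ha w hw).le, Real.div_rpow h20.le (hb w hw).le,
            Real.rpow_neg (ha w hw).le, Real.rpow_neg (hb w hw).le]
          have h7 := Real.rpow_pos_of_pos (ha w hw) τ
          have h8 := Real.rpow_pos_of_pos (hb w hw) (s - τ)
          field_simp
        rw [heq]
        exact le_mul_of_one_le_right (by positivity) hsum
      · intro w hw
        have h5 := (div_pos h1 (ha w hw))
        have h6 := (div_pos h20 (hb w hw))
        have := hP w hw
        positivity
  refine ⟨c, hc, fun r hr hrM => ?_⟩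
  obtain ⟨n, hn⟩ := exists_pow_lt_of_lt_one (div_pos hr hM) hβ
  have hbm1 : M ≤ M / bmin ∨ A = ∅ := by
    by_cases hA : A = ∅
    · exact Or.inr hA
    · left
      obtain ⟨w, hw⟩ := Finset.nonempty_iff_ne_empty.2 hA
      rw [le_div_iff₀ hbmin]
      have := hbm w hw
      have := hbβ w hw
      nlinarith
  rcases hbm1 with hbm1 | hA
  · have := key n r r hr le_rfl (by rw [lt_div_iff₀ hM] at hn; linarith) (by linarith)
    rwa [← Real.rpow_add hr, show -τ + -(s - τ) = -s by ring] at this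
  · rw [hA] at hsum; norm_num at hsum
namespace IFSData
variable {ι : Type}

theorem dims_cons (B : IFSData ι) (i : ι) (l : List ι) : B.dims (i :: l) =
    (B.c i * (if B.swap i then (B.dims l).2 else (B.dims l).1),
      B.d i * (if B.swap i then (B.dims l).1 else (B.dims l).2)) := rfl

theorem swapW_cons (B : IFSData ι) (i : ι) (l : List ι) :
    B.swapW (i :: l) = xor (B.swap i) (B.swapW l) := rfl

theorem Sw_cons (B : IFSData ι) (i : ι) (l : List ι) : B.Sw (i :: l) = B.S i ∘ B.Sw l := rfl

theorem measurable_S (B : IFSData ι) (i : ι) : Measurable (B.S i) := by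
  unfold S
  cases B.swap i <;> cases B.sgn1 i <;> cases B.sgn2 i <;> simp <;> fun_prop

theorem measurable_Sw (B : IFSData ι) (l : List ι) : Measurable (B.Sw l) := by
  induction l with
  | nil => exact measurable_id
  | cons i l ih => rw [Sw_cons]; exact (B.measurable_S i).comp ih

theorem dims_pos (B : IFSData ι) (hc : ∀ i, 0 < B.c i) (hd : ∀ i, 0 < B.d i) (l : List ι) :
    0 < (B.dims l).1 ∧ 0 < (B.dims l).2 := by
  induction l with
  | nil => simp [dims]
  | cons i l ih =>
    rw [dims_cons]
    have := hc i
    have := hd i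
    obtain ⟨h1, h2⟩ := ih
    cases B.swap i <;> simp <;> constructor <;> positivity

theorem dims_le (B : IFSData ι) (hc : ∀ i, 0 < B.c i) (hd : ∀ i, 0 < B.d i) {ρ : ℝ}
    (hcρ : ∀ i, B.c i ≤ ρ) (hdρ : ∀ i, B.d i ≤ ρ) (hρ : 0 < ρ) (l : List ι) :
    (B.dims l).1 ≤ ρ ^ l.length ∧ (B.dims l).2 ≤ ρ ^ l.length := by
  induction l with
  | nil => simp [dims]
  | cons i l ih =>
    rw [dims_cons]
    obtain ⟨p1, p2⟩ := B.dims_pos hc hd l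
    have := hc i
    have := hd i
    obtain ⟨h1, h2⟩ := ih
    rw [List.length_cons, pow_succ']
    cases B.swap i <;> simp <;> constructor <;> apply mul_le_mul <;>
      first | exact hcρ i | exact hdρ i | assumption | positivity

theorem Sw_diff (B : IFSData ι) (hc : ∀ i, 0 < B.c i) (hd : ∀ i, 0 < B.d i) (l : List ι)
    (x y : ℝ × ℝ) :
    |(B.Sw l y).1 - (B.Sw l x).1| =
      (B.dims l).1 * (if B.swapW l then |y.2 - x.2| else |y.1 - x.1|) ∧
    |(B.Sw l y).2 - (B.Sw l x).2| =
      (B.dims l).2 * (if B.swapW l then |y.1 - x.1| else |y.2 - x.2|) := by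
  induction l with
  | nil => simp [dims, swapW, Sw]
  | cons i l ih =>
    have e : ∀ (b : Bool) (k u v t : ℝ), 0 < k →
        |((if b then (1:ℝ) else -1) * (k * u) + t) - ((if b then (1:ℝ) else -1) * (k * v) + t)| =
        k * |u - v| := by
      intro b k u v t hk
      cases b
      · simp only [Bool.false_eq_true, if_false]
        rw [show (-1 * (k * u) + t) - (-1 * (k * v) + t) = -(k * (u - v)) by ring, abs_neg,
          abs_mul, abs_of_pos hk]
      · simp only [if_true]
        rw [show (1 * (k * u) + t) - (1 * (k * v) + t) = (k * (u - v)) by ring,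
          abs_mul, abs_of_pos hk]
    rw [dims_cons, swapW_cons, Sw_cons]
    obtain ⟨h1, h2⟩ := ih
    simp only [Function.comp, S]
    rw [e _ _ _ _ _ (hc i), e _ _ _ _ _ (hd i)]
    cases hs : B.swap i <;> cases hl : B.swapW l <;> simp [hl] at h1 h2 ⊢ <;>
      rw [h1, h2] <;> constructor <;> ring

end IFSData

theorem wordProb_pos {ι : Type} (p : ι → ℝ) (hp : ∀ i, 0 < p i) (l : List ι) :
    0 < wordProb p l := by
  induction l with
  | nil => simp [wordProb]
  | cons i l ih =>
    have : wordProb p (i :: l) = p i * wordProb p l := by simp [wordProb]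
    rw [this]; exact mul_pos (hp i) ih

theorem wordProb_cons {ι : Type} (p : ι → ℝ) (i : ι) (l : List ι) :
    wordProb p (i :: l) = p i * wordProb p l := by simp [wordProb]

theorem lintegral_words {ι : Type} [Fintype ι] (B : IFSData ι) (p : ι → ℝ) (hp : ∀ i, 0 < p i)
    (μ : Measure (ℝ × ℝ))
    (hself : μ = ∑ i : ι, ENNReal.ofReal (p i) • Measure.map (B.S i) μ) (k : ℕ) :
    ∀ g : ℝ × ℝ → ENNReal, Measurable g →
      ∑ f : Fin k → ι, ENNReal.ofReal (wordProb p (List.ofFn f)) *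
        ∫⁻ x, g (B.Sw (List.ofFn f) x) ∂μ = ∫⁻ x, g x ∂μ := by
  induction k with
  | zero => intro g hg; simp [wordProb, IFSData.Sw]
  | succ k ih =>
    intro g hg
    have h1 : ∫⁻ x, g x ∂μ = ∑ i, ENNReal.ofReal (p i) * ∫⁻ x, g (B.S i x) ∂μ := by
      conv_lhs => rw [hself]
      rw [lintegral_finsetSum_measure]
      apply Finset.sum_congr rfl
      intro i _
      rw [lintegral_smul_measure, lintegral_map hg (B.measurable_S i), smul_eq_mul]
    rw [h1, ← (Fin.consEquiv (fun _ : Fin (k+1) => ι)).sum_comp, Fintype.sum_prod_type]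
    apply Finset.sum_congr rfl
    intro i _
    rw [← ih (fun x => g (B.S i x)) (hg.comp (B.measurable_S i)), Finset.mul_sum]
    apply Finset.sum_congr rfl
    intro f _
    have : List.ofFn ((Fin.consEquiv (fun _ : Fin (k+1) => ι)) (i, f)) = i :: List.ofFn f := by
      simp [Fin.consEquiv, List.ofFn_succ]
    rw [this, wordProb_cons, IFSData.Sw_cons, ENNReal.ofReal_mul (hp i).le, mul_assoc]
    rfl
/-- Logarithm of the singular value function up to the common formula. -/
theorem psiSV_formula {ι : Type} (B : IFSData ι) (hc : ∀ i, 0 < B.c i) (hd : ∀ i, 0 < B.d i)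
    (p : ι → ℝ) (hp : ∀ i, 0 < p i) (τ1 τ2 : ℝ → ℝ) (s q : ℝ) (l : List ι) :
    psiSV B p τ1 τ2 s q l = Real.exp (q * Real.log (wordProb p l) +
      (s * Real.log (if B.swapW l then (B.dims l).1 else (B.dims l).2) +
       τ1 q * max (Real.log (if B.swapW l then (B.dims l).2 else (B.dims l).1) -
          Real.log (if B.swapW l then (B.dims l).1 else (B.dims l).2)) 0 +
       (s - τ2 q) * min (Real.log (if B.swapW l then (B.dims l).2 else (B.dims l).1) -
          Real.log (if B.swapW l then (B.dims l).1 else (B.dims l).2)) 0)) := by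
  obtain ⟨h1, h2⟩ := B.dims_pos hc hd l
  have hw := wordProb_pos p hp l
  unfold psiSV tauW IFSData.usesPi1 IFSData.alpha1 IFSData.alpha2
  generalize (B.dims l).1 = b at *
  generalize (B.dims l).2 = h at *
  rw [Real.rpow_def_of_pos hw, Real.rpow_def_of_pos (lt_max_of_lt_left h1),
    Real.rpow_def_of_pos (lt_min h1 h2), ← Real.exp_add, ← Real.exp_add]
  congr 1
  rcases lt_trichotomy b h with hlt | heq | hgt
  · have hl := Real.log_lt_log h1 hlt
    rw [max_eq_right hlt.le, min_eq_left hlt.le]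
    cases B.swapW l
    · simp only [Bool.false_eq_true, if_false, false_and, or_false, true_and, not_le.2 hlt]
      rw [max_eq_right (by linarith), min_eq_left (by linarith)]; ring
    · simp only [Bool.true_eq_false, if_true, false_and, false_or, true_and, hlt]
      rw [max_eq_left (by linarith), min_eq_right (by linarith)]; ring
  · subst heq
    simp only [max_self, min_self, ite_self, sub_self]
    ring
  · have hl := Real.log_lt_log h2 hgt
    rw [max_eq_left hgt.le, min_eq_right hgt.le]
    cases B.swapW l
    · simp only [Bool.false_eq_true, if_false, false_and, or_false, true_and, hgt.le, if_true]
      rw [max_eq_left (by linarith), min_eq_right (by linarith)]; ring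
    · simp only [Bool.true_eq_false, if_true, false_and, false_or, true_and, not_lt.2 hgt.le,
        if_false]
      rw [max_eq_right (by linarith), min_eq_left (by linarith)]; ring

theorem psiSV_prepend {ι : Type} (B : IFSData ι) (hc : ∀ i, 0 < B.c i) (hd : ∀ i, 0 < B.d i)
    (p : ι → ℝ) (hp : ∀ i, 0 < p i) (τ1 τ2 : ℝ → ℝ) (s q : ℝ) (e : ι) (he : B.swap e = true) :
    ∃ C > 0, ∀ l : List ι, B.swapW l = true →
      psiSV B p τ1 τ2 s q l ≤ C * psiSV B p τ1 τ2 s q (e :: l) := by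
  refine ⟨Real.exp (|q * Real.log (p e)| + |s * Real.log (B.d e)| +
    |τ1 q| * |Real.log (B.c e) - Real.log (B.d e)| +
    |s - τ2 q| * |Real.log (B.c e) - Real.log (B.d e)|), Real.exp_pos _, fun l hl => ?_⟩
  obtain ⟨h1, h2⟩ := B.dims_pos hc hd l
  have hw := wordProb_pos p hp l
  rw [psiSV_formula B hc hd p hp, psiSV_formula B hc hd p hp, ← Real.exp_add]
  apply Real.exp_le_exp.2
  rw [wordProb_cons, IFSData.dims_cons, IFSData.swapW_cons, he, hl,
    Real.log_mul (hp e).ne' hw.ne']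
  simp only [Bool.xor_self, Bool.false_eq_true, if_true, if_false]
  rw [Real.log_mul (hc e).ne' h2.ne', Real.log_mul (hd e).ne' h1.ne']
  generalize Real.log (B.dims l).1 = x
  generalize Real.log (B.dims l).2 = y
  generalize Real.log (B.c e) = c
  generalize Real.log (B.d e) = d
  have m1 := abs_max_sub_max_le_abs (y - x) ((c + y) - (d + x)) 0
  have m2 : |min (y - x) 0 - min ((c + y) - (d + x)) 0| ≤ |(y - x) - ((c + y) - (d + x))| := by
    simpa using abs_min_sub_min_le_max (y - x) 0 ((c + y) - (d + x)) 0
  rw [show (y - x) - ((c + y) - (d + x)) = -(c - d) by ring, abs_neg] at m1 m2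
  have k1 := neg_abs_le (q * Real.log (p e))
  have k2 := neg_abs_le (s * d)
  have k3 := mul_le_mul_of_nonneg_left m1 (abs_nonneg (τ1 q))
  have k4 := mul_le_mul_of_nonneg_left m2 (abs_nonneg (s - τ2 q))
  rw [← abs_mul] at k3 k4
  have k5 := (le_abs_self _).trans k3
  have k6 := (le_abs_self _).trans k4
  rw [mul_add, mul_add]
  nlinarith

theorem psiSV_pos {ι : Type} (B : IFSData ι) (hc : ∀ i, 0 < B.c i) (hd : ∀ i, 0 < B.d i)
    (p : ι → ℝ) (hp : ∀ i, 0 < p i) (τ1 τ2 : ℝ → ℝ) (s q : ℝ) (l : List ι) :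
    0 < psiSV B p τ1 τ2 s q l := by
  rw [psiSV_formula B hc hd p hp]; exact Real.exp_pos _

theorem exists_swap_letter {ι : Type} (B : IFSData ι) (l : List ι) (h : B.swapW l = true) :
    ∃ e, B.swap e = true := by
  induction l with
  | nil => simp [IFSData.swapW] at h
  | cons i l ih =>
    rw [IFSData.swapW_cons] at h
    cases hi : B.swap i
    · rw [hi] at h; exact ih (by simpa using h)
    · exact ⟨i, hi⟩

/-- Growth of the partition sums below `γ`. -/
theorem Psi_unbounded {ι : Type} [Fintype ι] [Nonempty ι] (B : IFSData ι)
    (hc : ∀ i, B.c i ∈ Set.Ioo (0 : ℝ) 1) (hd : ∀ i, B.d i ∈ Set.Ioo (0 : ℝ) 1)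
    (p : ι → ℝ) (hp : ∀ i, 0 < p i) (τ1 τ2 : ℝ → ℝ) (s g q : ℝ) (hsg : s < g)
    {ρ : ℝ} (hρ0 : 0 < ρ) (hρ1 : ρ < 1) (hcρ : ∀ i, B.c i ≤ ρ) (hdρ : ∀ i, B.d i ≤ ρ)
    (hP : Tendsto (fun k : ℕ => PsiSV B p τ1 τ2 k g q ^ ((k : ℝ)⁻¹)) atTop (nhds 1)) (C : ℝ) :
    ∃ k : ℕ, C < PsiSV B p τ1 τ2 k s q := by
  have hc' := fun i => (hc i).1
  have hd' := fun i => (hd i).1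
  set R := ρ ^ (s - g) with hR
  have hR1 : 1 < R := Real.one_lt_rpow_of_pos_of_lt_one_of_neg hρ0 hρ1 (by linarith)
  have hmono : ∀ k, PsiSV B p τ1 τ2 k g q * R ^ k ≤ PsiSV B p τ1 τ2 k s q := by
    intro k
    unfold PsiSV
    rw [Finset.sum_mul]
    apply Finset.sum_le_sum
    intro f _
    obtain ⟨h1, h2⟩ := B.dims_pos hc' hd' (List.ofFn f)
    obtain ⟨u1, u2⟩ := B.dims_le hc' hd' hcρ hdρ hρ0 (List.ofFn f)
    have hw := wordProb_pos p hp (List.ofFn f)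
    have ha1 : 0 < B.alpha1 (List.ofFn f) := lt_max_of_lt_left h1
    have ha2 : 0 < B.alpha2 (List.ofFn f) := lt_min h1 h2
    have ha2' : B.alpha2 (List.ofFn f) ≤ ρ ^ k := by
      have := (min_le_left _ (B.dims (List.ofFn f)).2).trans u1
      rw [List.length_ofFn] at this
      exact this
    have h3 : R ^ k ≤ B.alpha2 (List.ofFn f) ^ (s - g) := by
      rw [hR, ← Real.rpow_natCast, ← Real.rpow_mul hρ0.le, mul_comm, Real.rpow_mul hρ0.le,
        Real.rpow_natCast]
      exact Real.rpow_le_rpow_of_nonpos ha2 ha2' (by linarith)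
    have h4 : psiSV B p τ1 τ2 s q (List.ofFn f) =
        psiSV B p τ1 τ2 g q (List.ofFn f) * B.alpha2 (List.ofFn f) ^ (s - g) := by
      unfold psiSV
      rw [mul_assoc, mul_assoc, mul_assoc, ← Real.rpow_add ha2]
      congr 3; ring
    rw [h4]
    exact mul_le_mul_of_nonneg_left h3 (psiSV_pos B hc' hd' p hp τ1 τ2 g q _).le
  obtain ⟨θ, hθ1, hθ2⟩ := exists_between (show R⁻¹ < 1 from inv_lt_one_of_one_lt₀ hR1)
  have hR0 : 0 < R := by linarith
  have hθ0 : 0 < θ := (inv_pos.2 hR0).trans hθ1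
  have hθR : 1 < θ * R := by rwa [inv_lt_iff_one_lt_mul₀ hR0] at hθ1
  have e1 := hP.eventually (lt_mem_nhds hθ2)
  have e2 := (tendsto_pow_atTop_atTop_of_one_lt hθR).eventually_gt_atTop C
  obtain ⟨k, hk1, hk2, hk0⟩ := (e1.and (e2.and (eventually_gt_atTop 0))).exists
  refine ⟨k, hk2.trans_le (le_trans ?_ (hmono k))⟩
  have hnn : 0 ≤ PsiSV B p τ1 τ2 k g q :=
    Finset.sum_nonneg fun f _ => (psiSV_pos B hc' hd' p hp τ1 τ2 g q _).le
  rw [mul_pow]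
  apply mul_le_mul_of_nonneg_right _ (by positivity)
  have h5 := pow_le_pow_left₀ hθ0.le hk1.le k
  rwa [Real.rpow_inv_natCast_pow hnn hk0.ne'] at h5

theorem sum_nonswap {ι : Type} [Fintype ι] [Nonempty ι] (B : IFSData ι)
    (hc : ∀ i, 0 < B.c i) (hd : ∀ i, 0 < B.d i)
    (p : ι → ℝ) (hp : ∀ i, 0 < p i) (τ1 τ2 : ℝ → ℝ) (s q : ℝ)
    (hU : ∀ C : ℝ, ∃ k : ℕ, C < PsiSV B p τ1 τ2 k s q) :
    ∃ m : ℕ,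
      (1 < ∑ f ∈ Finset.univ.filter (fun f : Fin m → ι => B.swapW (List.ofFn f) = false ∧
        (B.dims (List.ofFn f)).2 ≤ (B.dims (List.ofFn f)).1), psiSV B p τ1 τ2 s q (List.ofFn f)) ∨
      (1 < ∑ f ∈ Finset.univ.filter (fun f : Fin m → ι => B.swapW (List.ofFn f) = false ∧
        (B.dims (List.ofFn f)).1 < (B.dims (List.ofFn f)).2),
          psiSV B p τ1 τ2 s q (List.ofFn f)) := by
  by_contra hcon
  push Not at hcon
  have hns : ∀ m : ℕ, ∑ f ∈ Finset.univ.filter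
      (fun f : Fin m → ι => B.swapW (List.ofFn f) = false),
      psiSV B p τ1 τ2 s q (List.ofFn f) ≤ 2 := by
    intro m
    obtain ⟨h1, h2⟩ := hcon m
    rw [← Finset.sum_filter_add_sum_filter_not _
      (fun f : Fin m → ι => (B.dims (List.ofFn f)).2 ≤ (B.dims (List.ofFn f)).1),
      Finset.filter_filter, Finset.filter_filter]
    simp only [not_le]
    linarith
  have hsw : ∃ C : ℝ, ∀ m : ℕ, ∑ f ∈ Finset.univ.filter
      (fun f : Fin m → ι => ¬ B.swapW (List.ofFn f) = false),
      psiSV B p τ1 τ2 s q (List.ofFn f) ≤ C := by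
    by_cases hex : ∃ e, B.swap e = true
    · obtain ⟨e, he⟩ := hex
      obtain ⟨C, hC, hCl⟩ := psiSV_prepend B hc hd p hp τ1 τ2 s q e he
      refine ⟨C * 2, fun m => ?_⟩
      refine le_trans ?_ (mul_le_mul_of_nonneg_left (hns (m + 1)) hC.le)
      rw [Finset.mul_sum]
      have hof : ∀ f : Fin m → ι, List.ofFn (Fin.cons e f : Fin (m+1) → ι) = e :: List.ofFn f := by
        intro f; simp [List.ofFn_succ]
      calc _ ≤ ∑ f ∈ Finset.univ.filter
            (fun f : Fin m → ι => ¬ B.swapW (List.ofFn f) = false),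
            C * psiSV B p τ1 τ2 s q (List.ofFn (Fin.cons e f : Fin (m+1) → ι)) := by
            apply Finset.sum_le_sum
            intro f hf
            rw [hof]
            apply hCl
            simpa using hf
        _ = ∑ f ∈ (Finset.univ.filter
            (fun f : Fin m → ι => ¬ B.swapW (List.ofFn f) = false)).image
              (fun f => (Fin.cons e f : Fin (m+1) → ι)),
            C * psiSV B p τ1 τ2 s q (List.ofFn f) := by
            rw [Finset.sum_image]
            intro f _ g _ hfg
            exact (Fin.cons_inj.1 hfg).2
        _ ≤ _ := by
            apply Finset.sum_le_sum_of_subset_of_nonneg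
            · intro g hg
              obtain ⟨f, hf, rfl⟩ := Finset.mem_image.1 hg
              rw [Finset.mem_filter] at hf ⊢
              refine ⟨Finset.mem_univ _, ?_⟩
              rw [hof, IFSData.swapW_cons, he]
              simpa using hf.2
            · intro f _ _
              exact mul_nonneg hC.le (psiSV_pos B hc hd p hp τ1 τ2 s q _).le
    · refine ⟨0, fun m => ?_⟩
      rw [Finset.filter_false_of_mem]
      · simp
      · intro f _ hf
        exact hex (exists_swap_letter B _ (by simpa using hf))
  obtain ⟨C, hC⟩ := hsw
  obtain ⟨k, hk⟩ := hU (2 + C)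
  have := Finset.sum_filter_add_sum_filter_not Finset.univ
    (fun f : Fin k → ι => B.swapW (List.ofFn f) = false)
    (fun f => psiSV B p τ1 τ2 s q (List.ofFn f))
  have h1 := hns k
  have h2 := hC k
  unfold PsiSV at hk
  linarith
theorem grid_bound (ν : Measure ℝ) [IsProbabilityMeasure ν] {R q r : ℝ} (hR : 0 < R)
    (hν : ν (Icc (-R) R)ᶜ = 0) (hq : 1 ≤ q) (hr : 0 < r) (hr1 : r < 1) :
    ENNReal.ofReal ((r / (2 * R + 2)) ^ q) ≤ ∫⁻ x, (ν (Metric.ball x r)) ^ (q - 1) ∂ν := by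
  set J : Finset ℤ := Finset.Icc ⌊-R / r⌋ ⌊R / r⌋ with hJ
  let A : ℤ → Set ℝ := fun j => Ico (j * r) ((j + 1) * r)
  have hcov : Icc (-R) R ⊆ ⋃ j ∈ J, A j := by
    intro x hx
    simp only [mem_iUnion]
    refine ⟨⌊x / r⌋, ?_, ?_, ?_⟩
    · rw [hJ, Finset.mem_Icc]
      exact ⟨Int.floor_le_floor (div_le_div_of_nonneg_right hx.1 hr.le),
        Int.floor_le_floor (div_le_div_of_nonneg_right hx.2 hr.le)⟩
    · have := Int.floor_le (x / r)
      rwa [le_div_iff₀ hr] at this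
    · have := Int.lt_floor_add_one (x / r)
      rwa [div_lt_iff₀ hr] at this
  have hcard : (J.card : ℝ) ≤ (2 * R + 2) / r := by
    have h0 : ⌊-R / r⌋ ≤ ⌊R / r⌋ :=
      Int.floor_le_floor (div_le_div_of_nonneg_right (by linarith) hr.le)
    have h1 : (J.card : ℤ) = ⌊R / r⌋ + 1 - ⌊-R / r⌋ := by
      rw [hJ, Int.card_Icc]; exact Int.toNat_of_nonneg (by omega)
    have h2 : (J.card : ℝ) = ⌊R / r⌋ + 1 - ⌊-R / r⌋ := by exact_mod_cast h1
    have h3 := Int.floor_le (R / r)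
    have h4 := Int.lt_floor_add_one (-R / r)
    have h5 : (2 * R + 2) / r = R / r - (-R / r) + 2 / r := by ring
    have h6 : 2 ≤ 2 / r := by rw [le_div_iff₀ hr]; linarith
    rw [h5, h2]
    linarith
  have hex : ∃ j ∈ J, ENNReal.ofReal (r / (2 * R + 2)) ≤ ν (A j) := by
    by_contra hcon
    push Not at hcon
    have hne : J.Nonempty := by
      rw [hJ, Finset.nonempty_Icc]
      exact Int.floor_le_floor (div_le_div_of_nonneg_right (by linarith) hr.le)
    have h1 : (1 : ENNReal) ≤ ∑ j ∈ J, ν (A j) := by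
      have h2 : ν (Icc (-R) R) = 1 := (prob_compl_eq_zero_iff measurableSet_Icc).1 hν
      rw [← h2]
      exact (measure_mono hcov).trans (measure_biUnion_finset_le _ _)
    have h3 : ∑ j ∈ J, ν (A j) < ∑ j ∈ J, ENNReal.ofReal (r / (2 * R + 2)) :=
      ENNReal.sum_lt_sum_of_nonempty hne hcon
    rw [Finset.sum_const, nsmul_eq_mul, ← ENNReal.ofReal_natCast,
      ← ENNReal.ofReal_mul (by positivity)] at h3
    have h4 := h1.trans_lt h3
    rw [ENNReal.one_lt_ofReal] at h4
    have h5 : (J.card : ℝ) * (r / (2 * R + 2)) ≤ (2 * R + 2) / r * (r / (2 * R + 2)) :=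
      mul_le_mul_of_nonneg_right hcard (by positivity)
    have h6 : (2 * R + 2) / r * (r / (2 * R + 2)) = 1 := by field_simp
    linarith
  obtain ⟨j, _, hj⟩ := hex
  have hrR : 0 < r / (2 * R + 2) := by positivity
  calc ENNReal.ofReal ((r / (2 * R + 2)) ^ q) = ENNReal.ofReal (r / (2 * R + 2)) ^ q := by
        rw [ENNReal.ofReal_rpow_of_pos hrR]
    _ ≤ ν (A j) ^ q := ENNReal.rpow_le_rpow hj (by linarith)
    _ = ν (A j) ^ (q - 1) * ν (A j) := by
        have := ENNReal.rpow_add_of_nonneg (x := ν (A j)) (q - 1) 1 (by linarith) zero_le_one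
        rw [ENNReal.rpow_one] at this
        rw [← this]; congr 1; ring
    _ = ∫⁻ x in A j, ν (A j) ^ (q - 1) ∂ν := by rw [setLIntegral_const]
    _ ≤ ∫⁻ x in A j, (ν (Metric.ball x r)) ^ (q - 1) ∂ν := by
        apply setLIntegral_mono' measurableSet_Ico
        intro x hx
        apply ENNReal.rpow_le_rpow _ (by linarith)
        apply measure_mono
        intro y hy
        rw [Metric.mem_ball, Real.dist_eq, abs_lt]
        obtain ⟨x1, x2⟩ := hx
        obtain ⟨y1, y2⟩ := hy
        constructor <;> nlinarith
    _ ≤ _ := setLIntegral_le_lintegral _ _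

theorem integral_eq_toReal {X : Type*} [MeasurableSpace X] [PseudoMetricSpace X] (ν : Measure X)
    [IsProbabilityMeasure ν] {q r : ℝ} (hq : 1 ≤ q)
    (hm : Measurable fun x => ν (Metric.ball x r)) :
    ∫ x, (ν (Metric.ball x r)).toReal ^ (q - 1) ∂ν =
      (∫⁻ x, (ν (Metric.ball x r)) ^ (q - 1) ∂ν).toReal := by
  rw [← integral_toReal (hm.pow_const _).aemeasurable]
  · simp only [ENNReal.toReal_rpow]
  · apply Filter.Eventually.of_forall
    intro x
    exact ENNReal.rpow_lt_top_of_nonneg (by linarith) (measure_ne_top _ _)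

theorem lint_le_one {X : Type*} [MeasurableSpace X] [PseudoMetricSpace X] (ν : Measure X)
    [IsProbabilityMeasure ν] {q r : ℝ} (hq : 1 ≤ q) :
    ∫⁻ x, (ν (Metric.ball x r)) ^ (q - 1) ∂ν ≤ 1 := by
  calc _ ≤ ∫⁻ x, 1 ∂ν := by
        apply lintegral_mono
        intro x
        exact ENNReal.rpow_le_one prob_le_one (by linarith)
    _ = 1 := by simp

theorem meas_ball_real (ν : Measure ℝ) [IsProbabilityMeasure ν] (r : ℝ) :
    Measurable fun x => ν (Metric.ball x r) := by
  have := meas_strip ν (π := id) measurable_id r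
  exact this

theorem DD_eventually {X : Type*} [MeasurableSpace X] (μ : Measure X) [IsProbabilityMeasure μ]
    {π : X → ℝ} (hπ : Measurable π) {q : ℝ} (hq : 1 ≤ q) {R : ℝ} (hR : 0 < R)
    (hb : ∀ᵐ x ∂μ, π x ∈ Icc (-R) R) {τ t : ℝ} (hτ : lowerLq (Measure.map π μ) q = τ)
    (ht : t < τ) :
    ∀ᶠ r in nhdsWithin (0:ℝ) (Ioi 0), ENNReal.ofReal (r ^ (-t)) ≤ DD μ π q r := by
  set ν := Measure.map π μ with hν
  have : IsProbabilityMeasure ν := Measure.isProbabilityMeasure_map hπ.aemeasurable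
  have hνR : ν (Icc (-R) R)ᶜ = 0 := by
    rw [hν, Measure.map_apply hπ measurableSet_Icc.compl]
    exact hb
  have hDD : ∀ r, DD μ π q r = ∫⁻ x, (ν (Metric.ball x r)) ^ (q - 1) ∂ν := by
    intro r
    rw [hν, lintegral_map ((meas_ball_real ν r).pow_const _) hπ]
    unfold DD
    apply lintegral_congr
    intro x
    rw [Measure.map_apply hπ Metric.isOpen_ball.measurableSet]
    rfl
  have hI : ∀ r, ∫ x, (ν (Metric.ball x r)).toReal ^ (q - 1) ∂ν = (DD μ π q r).toReal := by
    intro r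
    rw [hDD, integral_eq_toReal ν hq (meas_ball_real ν r)]
  have hfin : ∀ r, DD μ π q r ≠ ⊤ := by
    intro r
    rw [hDD]
    exact ((lint_le_one ν hq).trans_lt ENNReal.one_lt_top).ne
  have hlow : ∀ r, 0 < r → r < 1 → (r / (2 * R + 2)) ^ q ≤ (DD μ π q r).toReal := by
    intro r h0 h1
    have := grid_bound ν hR hνR hq h0 h1
    rw [← hDD] at this
    exact (ENNReal.ofReal_le_iff_le_toReal (hfin r)).1 this
  have hsmall : ∀ᶠ r in nhdsWithin (0:ℝ) (Ioi 0), r ∈ Ioo 0 (1 / (2 * R + 2)) :=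
    Ioo_mem_nhdsGT (by positivity)
  have hbdd : IsBoundedUnder (· ≥ ·) (nhdsWithin (0:ℝ) (Ioi 0)) (fun δ : ℝ =>
      Real.log (∫ x, (ν (Metric.ball x δ)).toReal ^ (q - 1) ∂ν) / (-Real.log δ)) := by
    refine ⟨-(2 * q), ?_⟩
    rw [eventually_map]
    filter_upwards [hsmall] with r hr
    have hR1 : 1 / (2 * R + 2) < 1 := by rw [div_lt_one (by positivity)]; linarith
    have hr0 := hr.1
    have hr1 : r < 1 := hr.2.trans hR1
    have h1 : 0 < -Real.log r := by have := Real.log_neg hr0 hr1; linarith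
    rw [ge_iff_le, le_div_iff₀ h1, hI]
    have h2 : 0 < r / (2 * R + 2) := by positivity
    refine le_trans ?_ (Real.log_le_log (Real.rpow_pos_of_pos h2 q) (hlow r hr0 hr1))
    rw [Real.log_rpow h2, Real.log_div hr0.ne' (by positivity)]
    have h3 : Real.log (2 * R + 2) ≤ - Real.log r := by
      rw [← Real.log_inv]
      apply Real.log_le_log (by positivity)
      have := hr.2
      rw [lt_div_iff₀ (by positivity)] at this
      rw [le_inv_comm₀ (by positivity) hr0, inv_eq_one_div]
      exact hr.2.le
    nlinarith
  have hev := eventually_lt_of_lt_liminf (show t < liminf _ _ from (lt_of_lt_of_eq ht hτ.symm)) hbdd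
  have hsmall1 : ∀ᶠ r in nhdsWithin (0:ℝ) (Ioi 0), r ∈ Ioo (0:ℝ) 1 := Ioo_mem_nhdsGT one_pos
  filter_upwards [hev, hsmall1] with r hr1 hr2
  obtain ⟨r0, r1⟩ := hr2
  have h1 : 0 < -Real.log r := by have := Real.log_neg r0 r1; linarith
  rw [lt_div_iff₀ h1, hI] at hr1
  have h2 : 0 < r / (2 * R + 2) := by positivity
  have hpos : 0 < (DD μ π q r).toReal := (Real.rpow_pos_of_pos h2 q).trans_le (hlow r r0 r1)
  rw [ENNReal.ofReal_le_iff_le_toReal (hfin r), Real.rpow_def_of_pos r0]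
  rw [← Real.exp_log hpos]
  apply Real.exp_le_exp.2
  linarith

theorem le_lowerLq_of_GG (μ : Measure (ℝ × ℝ)) [IsProbabilityMeasure μ] {π π' : ℝ × ℝ → ℝ}
    (hπ : Measurable π) (hπ' : Measurable π') {q : ℝ} (hq : 1 ≤ q)
    (hball : ∀ x r, Metric.ball x r = {y | |π y - π x| < r ∧ |π' y - π' x| < r})
    {c M s : ℝ} (hc : 0 < c) (hM : 0 < M)
    (h : ∀ r, 0 < r → r ≤ M → ENNReal.ofReal (c * r ^ (-s)) ≤ GG μ π π' q r r) :
    s ≤ lowerLq μ q := by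
  have hm : ∀ r, Measurable fun x => μ (Metric.ball x r) := by
    intro r
    simp only [hball]
    exact meas_rect μ hπ hπ' r r
  have hle1 : ∀ r, GG μ π π' q r r ≤ 1 := by
    intro r
    have := lint_le_one μ (r := r) hq
    simp only [hball] at this
    exact this
  have hI : ∀ r, ∫ x, (μ (Metric.ball x r)).toReal ^ (q - 1) ∂μ = (GG μ π π' q r r).toReal := by
    intro r
    rw [integral_eq_toReal μ hq (hm r)]
    simp only [hball]
    rfl
  have hsmall1 : ∀ᶠ r in nhdsWithin (0:ℝ) (Ioi 0), r ∈ Ioo (0:ℝ) 1 := Ioo_mem_nhdsGT one_pos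
  have hsmallM : ∀ᶠ r in nhdsWithin (0:ℝ) (Ioi 0), r ∈ Ioo (0:ℝ) M := Ioo_mem_nhdsGT hM
  have hlim : Tendsto (fun r : ℝ => s + Real.log c / (-Real.log r)) (nhdsWithin 0 (Ioi 0))
      (nhds (s + 0)) := by
    apply tendsto_const_nhds.add
    apply Tendsto.div_atTop tendsto_const_nhds
    exact tendsto_neg_atBot_atTop.comp Real.tendsto_log_nhdsGT_zero
  rw [add_zero] at hlim
  apply le_of_forall_lt
  intro s' hs'
  obtain ⟨s'', h1, h2⟩ := exists_between hs'
  refine h1.trans_le ?_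
  unfold lowerLq
  apply le_liminf_of_le
  · apply IsBoundedUnder.isCoboundedUnder_ge
    refine ⟨0, ?_⟩
    rw [eventually_map]
    filter_upwards [hsmall1] with r hr
    have h3 := Real.log_neg hr.1 hr.2
    apply div_nonpos_of_nonpos_of_nonneg _ (by linarith)
    rw [hI]
    apply Real.log_nonpos ENNReal.toReal_nonneg
    exact ENNReal.toReal_le_of_le_ofReal zero_le_one (by simpa using hle1 r)
  · filter_upwards [hsmall1, hsmallM, hlim.eventually (lt_mem_nhds h2)] with r hr hrM hr2
    refine hr2.le.trans ?_
    have h3 := Real.log_neg hr.1 hr.2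
    have h4 : 0 < -Real.log r := by linarith
    have h5 := h r hr.1 hrM.2.le
    rw [ENNReal.ofReal_le_iff_le_toReal ((hle1 r).trans_lt ENNReal.one_lt_top).ne] at h5
    have h6 : 0 < r ^ (-s) := Real.rpow_pos_of_pos hr.1 _
    have h7 := Real.log_le_log (by positivity) h5
    rw [Real.log_mul hc.ne' h6.ne', Real.log_rpow hr.1] at h7
    rw [hI, le_div_iff₀ h4, add_mul, div_mul_cancel₀ _ h4.ne']
    linarith

theorem axis_bound {κ : Type*} (μ : Measure (ℝ × ℝ)) [IsProbabilityMeasure μ]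
    {π π' : ℝ × ℝ → ℝ}
    (hπ : Measurable π) (hπ' : Measurable π') {q : ℝ} (hq : 1 ≤ q)
    (hball : ∀ x r, Metric.ball x r = {y | |π y - π x| < r ∧ |π' y - π' x| < r})
    (A : Finset κ) (T : κ → ℝ × ℝ → ℝ × ℝ) (P a b : κ → ℝ)
    (hP : ∀ w ∈ A, 0 < P w) (hb : ∀ w ∈ A, 0 < b w) (hba : ∀ w ∈ A, b w ≤ a w)
    (hTa : ∀ w ∈ A, ∀ x y, |π (T w y) - π (T w x)| = a w * |π y - π x|)
    (hTb : ∀ w ∈ A, ∀ x y, |π' (T w y) - π' (T w x)| = b w * |π' y - π' x|)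
    (hT : ∀ w, Measurable (T w))
    (hAint : ∀ g : ℝ × ℝ → ENNReal, Measurable g →
      ∑ w ∈ A, ENNReal.ofReal (P w) * ∫⁻ x, g (T w x) ∂μ ≤ ∫⁻ x, g x ∂μ)
    {R : ℝ} (hR : 0 < R) (hbd : ∀ᵐ x ∂μ, π x ∈ Icc (-R) R)
    (hbd' : ∀ᵐ x ∂μ, π' x ∈ Icc (-R) R)
    {β : ℝ} (hβ0 : 0 < β) (hβ : β < 1) (hbβ : ∀ w ∈ A, b w ≤ β)
    (s τ : ℝ) (hτ : lowerLq (Measure.map π μ) q = τ)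
    (hsum : 1 < ∑ w ∈ A, P w ^ q * a w ^ τ * b w ^ (s - τ)) : s ≤ lowerLq μ q := by
  have ha : ∀ w ∈ A, 0 < a w := fun w hw => (hb w hw).trans_le (hba w hw)
  have hA : A.Nonempty := by
    by_contra h
    rw [Finset.not_nonempty_iff_eq_empty] at h
    rw [h] at hsum; norm_num at hsum
  have hcont : ContinuousAt (fun t : ℝ => ∑ w ∈ A, P w ^ q * a w ^ t * b w ^ (s - t)) τ := by
    apply tendsto_finsetSum
    intro w hw
    apply Tendsto.mul
    · apply Tendsto.mul tendsto_const_nhds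
      exact (Real.continuousAt_const_rpow (ha w hw).ne')
    · have h1 : ContinuousAt (fun t : ℝ => s - t) τ := by fun_prop
      exact Tendsto.comp (Real.continuousAt_const_rpow (hb w hw).ne') h1
  have hev : ∀ᶠ t in nhdsWithin τ (Iio τ), 1 < ∑ w ∈ A, P w ^ q * a w ^ t * b w ^ (s - t) :=
    (hcont.eventually (lt_mem_nhds hsum)).filter_mono nhdsWithin_le_nhds
  obtain ⟨t, ht1, ht2⟩ := (hev.and self_mem_nhdsWithin).exists
  have ht2 : t < τ := ht2
  have hD := DD_eventually μ hπ hq hR hbd hτ ht2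
  obtain ⟨w0, hw0, hmin⟩ := A.exists_min_image b hA
  obtain ⟨c, hc, hcc⟩ := core_bound μ hπ hπ' hq A T P a b hP hb hba hTa hTb hT hAint
    (M := 2 * R + 1) (by linarith) (K := {x | π' x ∈ Icc (-R) R}) hbd'
    (by
      intro x hx y hy
      have hx1 : -R ≤ π' x ∧ π' x ≤ R := hx
      have hy1 : -R ≤ π' y ∧ π' y ≤ R := hy
      rw [abs_lt]; constructor <;> linarith)
    (hb w0 hw0) hmin hβ0 hβ hbβ s t ht1.le hD
  exact le_lowerLq_of_GG μ hπ hπ' hq hball hc (by linarith) hcc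
theorem gamma_le_lower_lq_spectrum
    {ι : Type} [Fintype ι] [Nonempty ι] (hcard : 2 ≤ Fintype.card ι)
    (B : IFSData ι)
    (hc : ∀ i, B.c i ∈ Set.Ioo (0 : ℝ) 1) (hd : ∀ i, B.d i ∈ Set.Ioo (0 : ℝ) 1)
    (p : ι → ℝ) (hp : ∀ i, p i ∈ Set.Ioo (0 : ℝ) 1) (hpsum : ∑ i : ι, p i = 1)
    (μ : Measure (ℝ × ℝ)) [IsProbabilityMeasure μ]
    (hcpt : ∃ K : Set (ℝ × ℝ), IsCompact K ∧ μ Kᶜ = 0)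
    (hself : μ = ∑ i : ι, ENNReal.ofReal (p i) • Measure.map (B.S i) μ)
    (τ1 τ2 : ℝ → ℝ)
    (hτ1 : ∀ q : ℝ, 0 ≤ q → IsLqSpec (Measure.map Prod.fst μ) q (τ1 q))
    (hτ2 : ∀ q : ℝ, 0 ≤ q → IsLqSpec (Measure.map Prod.snd μ) q (τ2 q))
    (P : ℝ → ℝ → ℝ)
    (hP : ∀ s q : ℝ, 0 ≤ q →
      Tendsto (fun k : ℕ => PsiSV B p τ1 τ2 k s q ^ ((k : ℝ)⁻¹)) atTop (nhds (P s q)))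
    (γ : ℝ → ℝ) (hγ : ∀ q : ℝ, 0 ≤ q → P (γ q) q = 1)
     :
    ∀ q : ℝ, 1 ≤ q → γ q ≤ lowerLq μ q := by
  intro q hq
  have hq0 : 0 ≤ q := by linarith
  have hc' := fun i => (hc i).1
  have hd' := fun i => (hd i).1
  have hp' := fun i => (hp i).1
  apply le_of_forall_lt
  intro s₀ hs₀
  obtain ⟨s, hs1, hs2⟩ := exists_between hs₀
  refine hs1.trans_le ?_
  -- uniform contraction ratio
  obtain ⟨ρ, hρ0, hρ1, hcρ, hdρ⟩ : ∃ ρ : ℝ, 0 < ρ ∧ ρ < 1 ∧ (∀ i, B.c i ≤ ρ) ∧ ∀ i, B.d i ≤ ρ := by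
    obtain ⟨i0, hi0⟩ := Finite.exists_max (fun i => max (B.c i) (B.d i))
    exact ⟨max (B.c i0) (B.d i0), lt_max_of_lt_left (hc' i0), max_lt (hc i0).2 (hd i0).2,
      fun i => (le_max_left _ _).trans (hi0 i), fun i => (le_max_right _ _).trans (hi0 i)⟩
  have hPg := hP (γ q) q hq0
  rw [hγ q hq0] at hPg
  obtain ⟨m, hm⟩ := sum_nonswap B hc' hd' p hp' τ1 τ2 s q
    (Psi_unbounded B hc hd p hp' τ1 τ2 s (γ q) q hs2 hρ0 hρ1 hcρ hdρ hPg)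
  have hm0 : m ≠ 0 := by
    rintro rfl
    have h1 : ∑ f : Fin 0 → ι, psiSV B p τ1 τ2 s q (List.ofFn f) = 1 := by
      simp [psiSV, wordProb, IFSData.alpha1, IFSData.alpha2, IFSData.dims]
    have h2 : ∀ A : Finset (Fin 0 → ι), ∑ f ∈ A, psiSV B p τ1 τ2 s q (List.ofFn f) ≤ 1 := by
      intro A
      rw [← h1]
      exact Finset.sum_le_sum_of_subset_of_nonneg (Finset.subset_univ _)
        fun f _ _ => (psiSV_pos B hc' hd' p hp' τ1 τ2 s q _).le
    rcases hm with hm | hm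
    · exact absurd (h2 _) (not_le.2 hm)
    · exact absurd (h2 _) (not_le.2 hm)
  obtain ⟨R, hR, hbd1, hbd2⟩ : ∃ R : ℝ, 0 < R ∧ (∀ᵐ x ∂μ, x.1 ∈ Icc (-R) R) ∧
      ∀ᵐ x ∂μ, x.2 ∈ Icc (-R) R := by
    obtain ⟨K, hK, hKμ⟩ := hcpt
    obtain ⟨R, hR⟩ := hK.isBounded.exists_norm_le
    have hae : ∀ᵐ x ∂μ, x ∈ K := hKμ
    refine ⟨|R| + 1, by positivity, ?_, ?_⟩
    · filter_upwards [hae] with x hx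
      have h1 := (norm_fst_le x).trans ((hR x hx).trans (le_abs_self R))
      rw [Real.norm_eq_abs, abs_le] at h1
      constructor <;> linarith
    · filter_upwards [hae] with x hx
      have h1 := (norm_snd_le x).trans ((hR x hx).trans (le_abs_self R))
      rw [Real.norm_eq_abs, abs_le] at h1
      constructor <;> linarith
  have hAint : ∀ A : Finset (Fin m → ι), ∀ g : ℝ × ℝ → ENNReal, Measurable g →
      ∑ w ∈ A, ENNReal.ofReal (wordProb p (List.ofFn w)) *
        ∫⁻ x, g (B.Sw (List.ofFn w) x) ∂μ ≤ ∫⁻ x, g x ∂μ := by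
    intro A g hg
    rw [← lintegral_words B p hp' μ hself m g hg]
    exact Finset.sum_le_sum_of_subset (Finset.subset_univ _)
  have hball : ∀ (x : ℝ × ℝ) (r : ℝ),
      Metric.ball x r = {y | |y.1 - x.1| < r ∧ |y.2 - x.2| < r} := by
    intro x r
    ext y
    simp [Metric.mem_ball, Prod.dist_eq, Real.dist_eq]
  have hdim : ∀ w : Fin m → ι, (B.dims (List.ofFn w)).1 ≤ ρ ^ m ∧
      (B.dims (List.ofFn w)).2 ≤ ρ ^ m := by
    intro w
    simpa using B.dims_le hc' hd' hcρ hdρ hρ0 (List.ofFn w)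
  rcases hm with hm | hm
  · refine axis_bound μ measurable_fst measurable_snd hq hball _
      (fun w : Fin m → ι => B.Sw (List.ofFn w)) (fun w => wordProb p (List.ofFn w))
      (fun w => (B.dims (List.ofFn w)).1) (fun w => (B.dims (List.ofFn w)).2)
      (fun w _ => wordProb_pos p hp' _) (fun w _ => (B.dims_pos hc' hd' _).2) ?_ ?_ ?_
      (fun w => B.measurable_Sw _) (hAint (Finset.univ.filter (fun f : Fin m → ι =>
        B.swapW (List.ofFn f) = false ∧
        (B.dims (List.ofFn f)).2 ≤ (B.dims (List.ofFn f)).1))) hR hbd1 hbd2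
      (pow_pos hρ0 m) (pow_lt_one₀ hρ0.le hρ1 hm0) (fun w _ => (hdim w).2)
      s (τ1 q) (hτ1 q hq0).1 ?_
    · intro w hw
      exact (Finset.mem_filter.1 hw).2.2
    · intro w hw x y
      have := (B.Sw_diff hc' hd' (List.ofFn w) x y).1
      rw [(Finset.mem_filter.1 hw).2.1] at this
      simpa using this
    · intro w hw x y
      have := (B.Sw_diff hc' hd' (List.ofFn w) x y).2
      rw [(Finset.mem_filter.1 hw).2.1] at this
      simpa using this
    · refine hm.trans_eq (Finset.sum_congr rfl fun w hw => ?_)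
      obtain ⟨-, h1, h2⟩ := Finset.mem_filter.1 hw
      have h3 : B.usesPi1 (List.ofFn w) := Or.inl ⟨h1, h2⟩
      unfold psiSV tauW IFSData.alpha1 IFSData.alpha2
      rw [if_pos h3, max_eq_left h2, min_eq_right h2]
  · refine axis_bound μ measurable_snd measurable_fst hq
      (fun x r => by rw [hball]; ext y; exact and_comm) _
      (fun w : Fin m → ι => B.Sw (List.ofFn w)) (fun w => wordProb p (List.ofFn w))
      (fun w => (B.dims (List.ofFn w)).2) (fun w => (B.dims (List.ofFn w)).1)
      (fun w _ => wordProb_pos p hp' _) (fun w _ => (B.dims_pos hc' hd' _).1) ?_ ?_ ?_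
      (fun w => B.measurable_Sw _) (hAint (Finset.univ.filter (fun f : Fin m → ι =>
        B.swapW (List.ofFn f) = false ∧
        (B.dims (List.ofFn f)).1 < (B.dims (List.ofFn f)).2))) hR hbd2 hbd1
      (pow_pos hρ0 m) (pow_lt_one₀ hρ0.le hρ1 hm0) (fun w _ => (hdim w).1)
      s (τ2 q) (hτ2 q hq0).1 ?_
    · intro w hw
      exact (Finset.mem_filter.1 hw).2.2.le
    · intro w hw x y
      have := (B.Sw_diff hc' hd' (List.ofFn w) x y).2
      rw [(Finset.mem_filter.1 hw).2.1] at this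
      simpa using this
    · intro w hw x y
      have := (B.Sw_diff hc' hd' (List.ofFn w) x y).1
      rw [(Finset.mem_filter.1 hw).2.1] at this
      simpa using this
    · refine hm.trans_eq (Finset.sum_congr rfl fun w hw => ?_)
      obtain ⟨-, h1, h2⟩ := Finset.mem_filter.1 hw
      have h3 : ¬ B.usesPi1 (List.ofFn w) := by
        rintro (⟨_, h⟩ | ⟨h, _⟩)
        · exact absurd h (not_le.2 h2)
        · rw [h1] at h; exact absurd h (by simp)
      unfold psiSV tauW IFSData.alpha1 IFSData.alpha2
      rw [if_neg h3, max_eq_right h2.le, min_eq_left h2.le]
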